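/- If G is a finite supersolvable group with Φ(G) ∩ [G,G] = 1, then m(G) = i(G); that is, G is flat. -/

import Mathlib

/-- A sequence of group elements is irredundant if no element lies in the
subgroup generated by the others. -/
def Irredundant {G : Type*} [Group G] {n : ℕ} (g : Fin n → G) : Prop :=
  ∀ i, g i ∉ Subgroup.closure (g '' {j | j ≠ i})

/-- A sequence of group elements generates the group. -/
def Generates {G : Type*} [Group G] {n : ℕ} (g : Fin n → G) : Prop :=
  Subgroup.closure (Set.range g) = ⊤

/-- A family of subgroups is in general position if removing any one member
strictly enlarges the intersection. -/
def InGeneralPosition {G : Type*} [Group G] {n : ℕ} (H : Fin n → Subgroup G) : Prop :=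
  ∀ i, (⨅ j, H j) < ⨅ j ∈ {j | j ≠ i}, H j

/-- `mG G` is the maximum length of an irredundant generating sequence of `G`. -/
noncomputable def mG (G : Type*) [Group G] : ℕ :=
  sSup {n | ∃ g : Fin n → G, Irredundant g ∧ Generates g}

/-- `iG G` is the maximum length of an irredundant sequence in `G`. -/
noncomputable def iG (G : Type*) [Group G] : ℕ :=
  sSup {n | ∃ g : Fin n → G, Irredundant g}

/-- `MaxDim G` is the maximum size of a family of maximal subgroups of `G`
in general position. -/
noncomputable def MaxDim (G : Type*) [Group G] : ℕ :=
  sSup {n | ∃ M : Fin n → Subgroup G, (∀ i, IsCoatom (M i)) ∧ InGeneralPosition M}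

/-- For subgroups `A B ≤ G` with `A` normal in `G`, the quotient `B / (A ∩ B)`
(that is, `B/A` when `A ≤ B`) is cyclic. -/
def CyclicQuot {G : Type*} [Group G] (A B : Subgroup G) (hA : A.Normal) : Prop := by
  letI : (A.subgroupOf B).Normal := hA.subgroupOf B
  exact IsCyclic (B ⧸ A.subgroupOf B)

/-- For subgroups `A ≤ B ≤ G` with `A` normal in `G`, the quotient `B/A`
is cyclic of prime order. -/
def PrimeCyclicQuot {G : Type*} [Group G] (A B : Subgroup G) (hA : A.Normal) : Prop := by
  letI : (A.subgroupOf B).Normal := hA.subgroupOf B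
  exact IsCyclic (B ⧸ A.subgroupOf B) ∧ (Nat.card (B ⧸ A.subgroupOf B)).Prime

/-- A group `G` is supersolvable if it has a chain
`1 = G₀ ≤ G₁ ≤ ⋯ ≤ Gₙ = G` of subgroups, each normal in `G`, with each
successive quotient `G_{i+1}/G_i` cyclic. -/
def Supersolvable (G : Type*) [Group G] : Prop :=
  ∃ (n : ℕ) (H : Fin (n + 1) → Subgroup G) (hnorm : ∀ i, (H i).Normal),
    H 0 = ⊥ ∧ H (Fin.last n) = ⊤ ∧
    (∀ i : Fin n, H i.castSucc ≤ H i.succ) ∧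
    ∀ i : Fin n, CyclicQuot (H i.castSucc) (H i.succ) (hnorm i.castSucc)

open Subgroup
open scoped commutatorElement

/-- A sequence is irredundant modulo `W` if no element lies in the subgroup generated by `W`
and the others. -/
def IrredundantMod {G : Type*} [Group G] (W : Subgroup G) {n : ℕ} (g : Fin n → G) : Prop :=
  ∀ i, g i ∉ W ⊔ closure (g '' {j | j ≠ i})

/-- A sequence generates modulo `W` if together with `W` it generates the group. -/
def GeneratesMod {G : Type*} [Group G] (W : Subgroup G) {n : ℕ} (g : Fin n → G) : Prop :=
  W ⊔ closure (Set.range g) = ⊤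

/-- Every sequence irredundant modulo `W` is at most as long as some sequence that is irredundant
and generating modulo `W`. -/
def FlatMod {G : Type*} [Group G] (W : Subgroup G) : Prop :=
  ∀ (n : ℕ) (g : Fin n → G), IrredundantMod W g →
    ∃ (m : ℕ) (h : Fin m → G), n ≤ m ∧ IrredundantMod W h ∧ GeneratesMod W h

section General

variable {G : Type*} [Group G]

lemma irredundantMod_bot {n : ℕ} {g : Fin n → G} : IrredundantMod ⊥ g ↔ Irredundant g := by
  simp [IrredundantMod, Irredundant]

lemma generatesMod_bot {n : ℕ} {g : Fin n → G} : GeneratesMod ⊥ g ↔ Generates g := by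
  simp [GeneratesMod, Generates]

lemma sup_closure_eq_of_congr {W : Subgroup G} {n : ℕ} {g k : Fin n → G}
    (h : ∀ i, ∃ w ∈ W, w * k i = g i) (S : Set (Fin n)) :
    W ⊔ closure (g '' S) = W ⊔ closure (k '' S) := by
  choose w hw hwk using h
  refine le_antisymm (sup_le le_sup_left ?_) (sup_le le_sup_left ?_) <;>
    rw [closure_le] <;> rintro _ ⟨i, hi, rfl⟩
  · rw [← hwk]
    exact mul_mem (mem_sup_left (hw i)) (mem_sup_right (subset_closure ⟨i, hi, rfl⟩))
  · rw [← inv_mul_eq_of_eq_mul (hwk i).symm]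
    exact mul_mem (inv_mem (mem_sup_left (hw i))) (mem_sup_right (subset_closure ⟨i, hi, rfl⟩))

/-- Passing from `W` down to `W ⊓ K` with `K` maximal lengthens an irredundant generating
sequence by one. -/
lemma exists_irredundantMod_inf_coatom {W K : Subgroup G} [W.Normal] (hK : IsCoatom K)
    (hWK : ¬ W ≤ K) {n : ℕ} {g : Fin n → G} (hg : IrredundantMod W g) (hgen : GeneratesMod W g) :
    ∃ h : Fin (n + 1) → G, IrredundantMod (W ⊓ K) h ∧ GeneratesMod (W ⊓ K) h := by
  have hsup : W ⊔ K = ⊤ := by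
    rw [sup_comm]
    exact hK.2 _ (lt_of_le_of_ne le_sup_left fun h => hWK (h ▸ le_sup_right))
  have hex : ∀ i, ∃ k ∈ K, ∃ w ∈ W, w * k = g i := by
    intro i
    have : g i ∈ W ⊔ K := hsup ▸ mem_top _
    obtain ⟨w, hw, k, hk, h⟩ := mem_sup_of_normal_left.1 this
    exact ⟨k, hk, w, hw, h⟩
  choose k hkK hk using hex
  have hcl := sup_closure_eq_of_congr hk
  obtain ⟨x, hxW, hxK⟩ := SetLike.not_le_iff_exists.1 hWK
  have hkcl : ∀ S : Set (Fin n), closure (k '' S) ≤ K := by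
    intro S
    rw [closure_le]
    rintro _ ⟨i, -, rfl⟩
    exact hkK i
  refine ⟨Fin.cons x k, fun i => ?_, ?_⟩
  · refine Fin.cases ?_ (fun i => ?_) i
    · intro hx
      refine hxK ((sup_le inf_le_right ?_ : _ ≤ K) hx)
      rw [closure_le]
      rintro _ ⟨j, hj, rfl⟩
      obtain ⟨j, rfl⟩ := Fin.exists_succ_eq.2 hj
      exact hkK j
    · intro hi
      have h1 : k i ∈ W ⊔ closure (k '' {j | j ≠ i}) := by
        refine (sup_le (inf_le_left.trans le_sup_left) ?_ :
          _ ≤ W ⊔ closure (k '' {j | j ≠ i})) hi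
        rw [closure_le]
        rintro _ ⟨j, hj, rfl⟩
        revert hj
        refine Fin.cases (fun _ => mem_sup_left hxW) (fun j hj => ?_) j
        exact mem_sup_right (subset_closure ⟨j, fun h => hj (by rw [h]), rfl⟩)
      rw [← hcl] at h1
      obtain ⟨w, hw, hwk⟩ := hk i
      exact hg i (hwk ▸ mul_mem (mem_sup_left hw) h1)
  · refine hK.2 _ (lt_of_le_of_ne ?_ fun h => hxK ?_)
    · intro y hy
      have h1 : y ∈ W ⊔ closure (k '' Set.univ) := by
        rw [← hcl, Set.image_univ, hgen]
        exact mem_top _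
      obtain ⟨w, hw, b, hb, rfl⟩ := mem_sup_of_normal_left.1 h1
      have hwK : w ∈ K := by simpa using mul_mem hy (inv_mem (hkcl _ hb))
      refine mul_mem (mem_sup_left ⟨hw, hwK⟩) (mem_sup_right (Subgroup.closure_mono ?_ hb))
      rintro _ ⟨i, -, rfl⟩
      exact ⟨i.succ, rfl⟩
    · rw [h]
      exact mem_sup_right (subset_closure ⟨0, rfl⟩)

/-- If `V` is covered by the normal subgroup `W`, removing at most one element makes a sequence
that is irredundant modulo `V` irredundant modulo `W`. -/
lemma IrredundantMod.of_covBy {V W : Subgroup G} [W.Normal] (hVW : V ⋖ W) {n : ℕ}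
    {g : Fin (n + 1) → G} (hg : IrredundantMod V g) (h : ¬ IrredundantMod W g) :
    ∃ k : Fin n → G, IrredundantMod W k := by
  simp only [IrredundantMod, not_forall, not_not] at h
  obtain ⟨i, hi⟩ := h
  refine ⟨g ∘ i.succAbove, fun a ha => ?_⟩
  set B := V ⊔ closure ((g ∘ i.succAbove) '' {j | j ≠ a})
  set C := V ⊔ closure (g '' {j | j ≠ i})
  have hBC : B ≤ C := by
    refine sup_le_sup_left (Subgroup.closure_mono ?_) _
    rintro _ ⟨j, -, rfl⟩
    exact ⟨_, Fin.succAbove_ne i j, rfl⟩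
  have haC : g (i.succAbove a) ∈ C :=
    mem_sup_right (subset_closure ⟨_, Fin.succAbove_ne i a, rfl⟩)
  have haB : g (i.succAbove a) ∉ B := by
    refine fun h => hg (i.succAbove a) ((sup_le_sup_left (Subgroup.closure_mono ?_) V : B ≤ _) h)
    rintro _ ⟨j, hj, rfl⟩
    exact ⟨_, fun h => hj (Fin.succAbove_right_injective h), rfl⟩
  obtain ⟨w, hw, b, hb, hwb⟩ := mem_sup_of_normal_left.1 ha
  have hbB : b ∈ B := mem_sup_right hb
  obtain ⟨w', hw', c, hc, hwc⟩ := mem_sup_of_normal_left.1 hi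
  have hcC : c ∈ C := mem_sup_right hc
  have hwb' : w * b = g (i.succAbove a) := hwb
  refine hVW.2 (c := C ⊓ W) (lt_of_le_of_ne (le_inf le_sup_left hVW.le) fun h => haB ?_)
    (lt_of_le_of_ne inf_le_right fun h => hg i ?_)
  · have hwV : w ∈ V := by
      rw [h]
      refine ⟨?_, hw⟩
      rw [← hwb'] at haC
      simpa using mul_mem haC (inv_mem (hBC hbB))
    exact hwb' ▸ mul_mem (mem_sup_left hwV) hbB
  · have : w' ∈ C := inf_eq_right.1 h hw'
    exact hwc ▸ mul_mem this hcC

lemma FlatMod.inf_coatom {W K : Subgroup G} [W.Normal] (hK : IsCoatom K) (hWK : ¬ W ≤ K)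
    (hcov : W ⊓ K ⋖ W) (hW : FlatMod W) : FlatMod (W ⊓ K) := by
  intro n g hg
  have key : ∃ m ≥ n - 1, ∃ k : Fin m → G, IrredundantMod W k := by
    by_cases h : IrredundantMod W g
    · exact ⟨n, Nat.sub_le _ _, g, h⟩
    · cases n with
      | zero => exact absurd (fun i => i.elim0) h
      | succ n => exact ⟨n, le_rfl, hg.of_covBy hcov h⟩
  obtain ⟨m, hm, k, hk⟩ := key
  obtain ⟨l, h, hl, hh, hgen⟩ := hW m k hk
  obtain ⟨h', hh', hgen'⟩ := exists_irredundantMod_inf_coatom hK hWK hh hgen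
  exact ⟨l + 1, h', by omega, hh', hgen'⟩

lemma covBy_of_prime_relIndex {V W : Subgroup G} (h : V ≤ W) (hp : (V.relIndex W).Prime) :
    V ⋖ W := by
  refine ⟨lt_of_le_of_ne h ?_, fun X hVX hXW => ?_⟩
  · rintro rfl
    simp [Nat.not_prime_one] at hp
  · rw [← relIndex_mul_relIndex V X W hVX.le hXW.le, Nat.prime_mul_iff] at hp
    rcases hp with ⟨-, h⟩ | ⟨-, h⟩
    · exact hXW.not_ge (relIndex_eq_one.1 h)
    · exact hVX.not_ge (relIndex_eq_one.1 h)

lemma relIndex_eq_index_of_isCoatom [Finite G] {W K : Subgroup G} [W.Normal] (hK : IsCoatom K)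
    (hWK : ¬ W ≤ K) : (W ⊓ K).relIndex W = K.index := by
  have hsup : K ⊔ W = ⊤ := hK.2 _ (lt_of_le_of_ne le_sup_left fun h => hWK (h ▸ le_sup_right))
  have h1 : (W ⊓ K).relIndex K = W.index := by
    rw [inf_relIndex_right, ← relIndex_sup_right, hsup, relIndex_top_right]
  have h2 := relIndex_mul_index (inf_le_left : W ⊓ K ≤ W)
  rw [← relIndex_mul_index (inf_le_right : W ⊓ K ≤ K), h1, mul_comm] at h2
  exact Nat.eq_of_mul_eq_mul_left (Nat.pos_of_ne_zero FiniteIndex.index_ne_zero)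
    h2

/-- A maximal subgroup missing a generator of a cyclic normal subgroup has prime index. -/
lemma IsCoatom.prime_index_of_zpowers_normal [Finite G] {K : Subgroup G} (hK : IsCoatom K) {c : G}
    (hc : (zpowers c).Normal) (hcK : c ∉ K) : K.index.Prime := by
  have hzK : ¬ zpowers c ≤ K := by simpa using hcK
  rw [← relIndex_eq_index_of_isCoatom hK hzK, inf_comm, inf_relIndex_right]
  set d : zpowers c ⧸ K.subgroupOf (zpowers c) := QuotientGroup.mk ⟨c, mem_zpowers c⟩
  have hd : orderOf d = K.relIndex (zpowers c) := by
    refine orderOf_eq_card_of_forall_mem_zpowers fun x => ?_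
    obtain ⟨⟨_, ⟨k, rfl⟩⟩, rfl⟩ := QuotientGroup.mk_surjective x
    exact ⟨k, rfl⟩
  have hpow : ∀ k : ℤ, c ^ k ∈ K ↔ (orderOf d : ℤ) ∣ k := by
    intro k
    rw [orderOf_dvd_iff_zpow_eq_one]
    exact (QuotientGroup.eq_one_iff (N := K.subgroupOf (zpowers c))
      ((⟨c, mem_zpowers c⟩ : zpowers c) ^ k)).symm
  rw [← hd]
  have h1 : orderOf d ≠ 1 := fun h => hcK (by simpa [h] using hpow 1)
  obtain ⟨p, hp, hpd⟩ := Nat.exists_prime_and_dvd h1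
  by_cases hcp : c ^ p ∈ K
  · have : orderOf d ∣ p := by exact_mod_cast (hpow p).1 (by exact_mod_cast hcp)
    rwa [Nat.dvd_antisymm this hpd]
  · exfalso
    have hn : (zpowers (c ^ p)).Normal := by
      refine ⟨fun x hx g => ?_⟩
      obtain ⟨j, rfl⟩ := hx
      obtain ⟨k, hk⟩ := hc.conj_mem c (mem_zpowers c) g
      refine ⟨j * k, ?_⟩
      simp only at hk ⊢
      rw [← conj_zpow, ← conj_pow, ← hk]
      simp only [← zpow_natCast, ← zpow_mul]
      ring_nf
    have hsup : zpowers (c ^ p) ⊔ K = ⊤ := by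
      rw [sup_comm]
      refine hK.2 _ (lt_of_le_of_ne le_sup_left fun h => hcp ?_)
      rw [h]
      exact mem_sup_right (mem_zpowers _)
    obtain ⟨_, ⟨j, rfl⟩, k, hk, hjk⟩ := mem_sup_of_normal_left.1 (hsup ▸ mem_top c)
    have hkc : k = c ^ (1 - (p : ℤ) * j) := by
      rw [eq_inv_mul_of_mul_eq hjk, sub_eq_neg_add, zpow_add, zpow_neg, zpow_mul, zpow_natCast,
        zpow_one]
    rw [hkc, hpow] at hk
    have h2 : (p : ℤ) ∣ 1 := by
      have := (Int.natCast_dvd_natCast.2 hpd).trans hk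
      simpa using dvd_add this (dvd_mul_right (p : ℤ) j)
    exact hp.one_lt.ne' (by exact_mod_cast Int.natAbs_dvd_natAbs.2 h2 |> Nat.dvd_one.1)

/-- The second derived subgroup lies in every maximal subgroup missing a generator of a cyclic
normal subgroup. -/
lemma IsCoatom.commutator_commutator_le_of_zpowers_normal {K : Subgroup G} (hK : IsCoatom K)
    {c : G} (hc : (zpowers c).Normal) (hcK : c ∉ K) : ⁅commutator G, commutator G⁆ ≤ K := by
  have hcent : commutator G ≤ centralizer {c} := by
    have hconj : ∀ g h : G, (g * h) * c * (g * h)⁻¹ = (h * g) * c * (h * g)⁻¹ := by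
      intro g h
      obtain ⟨a, ha⟩ := hc.conj_mem c (mem_zpowers c) g
      obtain ⟨b, hb⟩ := hc.conj_mem c (mem_zpowers c) h
      simp only at ha hb
      calc (g * h) * c * (g * h)⁻¹ = g * (h * c * h⁻¹) * g⁻¹ := by group
        _ = c ^ (a * b) := by rw [← hb, ← conj_zpow, ← ha, zpow_mul]
        _ = c ^ (b * a) := by rw [mul_comm]
        _ = h * (g * c * g⁻¹) * h⁻¹ := by rw [← ha, ← conj_zpow, ← hb, zpow_mul]
        _ = _ := by group
    rw [commutator_eq_closure, closure_le]
    rintro _ ⟨g, h, rfl⟩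
    rw [SetLike.mem_coe, mem_centralizer_singleton_iff, ← mul_inv_eq_iff_eq_mul]
    calc ⁅g, h⁆ * c * ⁅g, h⁆⁻¹ = g * h * (g⁻¹ * h⁻¹ * c * (g⁻¹ * h⁻¹)⁻¹) * (g * h)⁻¹ := by
          rw [commutatorElement_def]; group
      _ = c := by rw [hconj]; group
  have hsup : zpowers c ⊔ K = ⊤ := by
    rw [sup_comm]
    refine hK.2 _ (lt_of_le_of_ne le_sup_left fun h => hcK ?_)
    rw [h]
    exact mem_sup_right (mem_zpowers _)
  have hex : ∀ x ∈ commutator G, ∃ k ∈ K, ∃ i : ℤ, c ^ i * k = x ∧ Commute k c := by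
    intro x hx
    obtain ⟨_, ⟨i, rfl⟩, k, hk, hik⟩ := mem_sup_of_normal_left.1 (hsup ▸ mem_top x)
    refine ⟨k, hk, i, hik, ?_⟩
    have hxc : Commute x c := mem_centralizer_singleton_iff.1 (hcent hx)
    have : k = c ^ (-i) * x := by rw [← hik]; simp
    rw [this]
    exact ((Commute.refl c).zpow_left _).mul_left hxc
  rw [commutator_le]
  intro x hx y hy
  obtain ⟨k, hk, i, rfl, hkc⟩ := hex x hx
  obtain ⟨l, hl, j, rfl, hlc⟩ := hex y hy
  have : ⁅c ^ i * k, c ^ j * l⁆ = ⁅k, l⁆ := by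
    have e1 : c ^ i * k * (c ^ j * l) = c ^ (i + j) * (k * l) := by
      rw [zpow_add, mul_assoc, ← mul_assoc k, (hkc.zpow_right j).eq]; group
    have e2 : c ^ j * l * (c ^ i * k) = c ^ (i + j) * (l * k) := by
      rw [add_comm, zpow_add, mul_assoc, ← mul_assoc l, (hlc.zpow_right i).eq]; group
    have e3 : ∀ u v : G, ⁅u, v⁆ = (u * v) * (v * u)⁻¹ := fun u v => by
      simp [commutatorElement_def, mul_assoc]
    rw [e3, e1, e2, e3]
    have hc1 : Commute (k * l * (l * k)⁻¹) (c ^ (i + j)) :=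
      ((hkc.mul_left hlc).mul_left (hlc.mul_left hkc).inv_left).zpow_right _
    rw [mul_inv_rev (c ^ (i + j)), ← mul_assoc, mul_assoc (c ^ (i + j)), ← hc1.eq,
      mul_inv_cancel_right]
  rw [this]
  exact mul_mem (mul_mem (mul_mem hk hl) (inv_mem hk)) (inv_mem hl)

/-- Below any maximal subgroup of a supersolvable group sits a normal subgroup modulo which the
maximal subgroup misses a generator of a cyclic normal subgroup. -/
lemma Supersolvable.exists_zpowers_normal (hG : Supersolvable G) {K : Subgroup G}
    (hK : IsCoatom K) : ∃ (N : Subgroup G) (_ : N.Normal) (c : G ⧸ N), N ≤ K ∧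
      (zpowers c).Normal ∧ c ∉ K.map (QuotientGroup.mk' N) := by
  obtain ⟨n, H, hn, h0, h1, hle, hcyc⟩ := hG
  have : ∃ i : Fin n, H i.castSucc ≤ K ∧ ¬ H i.succ ≤ K := by
    by_contra! hcon
    have : ∀ i, H i ≤ K := by
      intro i
      induction i using Fin.induction with
      | zero => simp [h0]
      | succ i ih => exact hcon i ih
    exact hK.1 (top_le_iff.1 (h1 ▸ this (Fin.last n)))
  obtain ⟨i, hiK, hsK⟩ := this
  have := hn i.castSucc
  have := hn i.succ
  have hcy := hcyc i
  simp only [CyclicQuot] at hcy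
  obtain ⟨d, hd⟩ := hcy.exists_generator
  obtain ⟨c, rfl⟩ := QuotientGroup.mk_surjective d
  have hz : zpowers (QuotientGroup.mk' (H i.castSucc) (c : G)) =
      (H i.succ).map (QuotientGroup.mk' (H i.castSucc)) := by
    refine le_antisymm (by simpa using ⟨_, c.2, rfl⟩) ?_
    rintro _ ⟨x, hx, rfl⟩
    obtain ⟨k, hk⟩ := hd (⟨x, hx⟩ : H i.succ)
    refine ⟨k, ?_⟩
    have h2 : ((c ^ k : H i.succ) : H i.succ ⧸ (H i.castSucc).subgroupOf (H i.succ)) =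
      QuotientGroup.mk ⟨x, hx⟩ := hk
    rw [QuotientGroup.eq, mem_subgroupOf] at h2
    exact QuotientGroup.eq.2 h2
  refine ⟨H i.castSucc, hn _, QuotientGroup.mk' _ (c : G), hiK, ?_, fun hcK => hsK ?_⟩
  · rw [hz]
    exact (hn i.succ).map _ (QuotientGroup.mk'_surjective _)
  · have : (H i.succ).map (QuotientGroup.mk' (H i.castSucc)) ≤
        K.map (QuotientGroup.mk' (H i.castSucc)) := by
      rw [← hz]; simpa using hcK
    have h2 := comap_mono (f := QuotientGroup.mk' (H i.castSucc)) this
    rw [comap_map_eq_self (H := K) (by simpa using hiK)] at h2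
    exact (le_comap_map _ _).trans h2

lemma isCoatom_map_mk' {K N : Subgroup G} [N.Normal] (hK : IsCoatom K) (hN : N ≤ K) :
    IsCoatom (K.map (QuotientGroup.mk' N)) := by
  have hcm : (K.map (QuotientGroup.mk' N)).comap (QuotientGroup.mk' N) = K :=
    comap_map_eq_self (by simpa using hN)
  refine ⟨fun h => hK.1 ?_, fun X hX => ?_⟩
  · rw [← hcm, h, comap_top]
  · have := hK.2 (X.comap (QuotientGroup.mk' N)) (hcm ▸
      (comap_lt_comap_of_surjective (QuotientGroup.mk'_surjective N)).2 hX)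
    exact comap_injective (QuotientGroup.mk'_surjective N) (this.trans (comap_top _).symm)

lemma Supersolvable.prime_index [Finite G] (hG : Supersolvable G) {K : Subgroup G}
    (hK : IsCoatom K) : K.index.Prime := by
  obtain ⟨N, _, c, hN, hc, hcK⟩ := hG.exists_zpowers_normal hK
  have := (isCoatom_map_mk' hK hN).prime_index_of_zpowers_normal hc hcK
  rwa [← index_comap_of_surjective _ (QuotientGroup.mk'_surjective N),
    comap_map_eq_self (by simpa using hN)] at this

lemma Supersolvable.commutator_commutator_le (hG : Supersolvable G) {K : Subgroup G}
    (hK : IsCoatom K) : ⁅commutator G, commutator G⁆ ≤ K := by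
  obtain ⟨N, _, c, hN, hc, hcK⟩ := hG.exists_zpowers_normal hK
  have := (isCoatom_map_mk' hK hN).commutator_commutator_le_of_zpowers_normal hc hcK
  rw [← comap_map_eq_self (show (QuotientGroup.mk' N).ker ≤ K by simpa using hN),
    ← map_le_iff_le_comap, map_commutator]
  refine le_trans (commutator_mono ?_ ?_) this <;>
  · rw [_root_.commutator_def, map_commutator]
    exact commutator_mono le_top le_top

end General

section Abelian

open ArithmeticFunction.Omega

lemma mem_of_zpow_mem_of_isCoprime {G : Type*} [Group G] {K : Subgroup G} {x : G}
    {a b : ℤ} (h : IsCoprime a b) (ha : x ^ a ∈ K)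
    (hb : x ^ b ∈ K) : x ∈ K := by
  obtain ⟨u, v, huv⟩ := h
  have : x = (x ^ a) ^ u * (x ^ b) ^ v := by
    rw [← zpow_mul, ← zpow_mul, ← zpow_add, mul_comm a, mul_comm b, huv, zpow_one]
  rw [this]
  exact mul_mem (zpow_mem ha u) (zpow_mem hb v)

variable {A : Type*} [CommGroup A] [Finite A]

lemma cardFactors_le_of_dvd {a b : ℕ} (h : a ∣ b) (hb : b ≠ 0) : Ω a ≤ Ω b := by
  obtain ⟨c, rfl⟩ := h
  rw [ArithmeticFunction.cardFactors_mul (left_ne_zero_of_mul hb) (right_ne_zero_of_mul hb)]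
  exact Nat.le_add_right _ _

lemma IrredundantMod.le_cardFactors_relIndex {G : Type*} [Group G] [Finite G] {W : Subgroup G}
    {n : ℕ} {g : Fin n → G} (hg : IrredundantMod W g) :
    n ≤ Ω (W.relIndex (W ⊔ closure (Set.range g))) := by
  induction n with
  | zero => exact Nat.zero_le _
  | succ n ih =>
    have hg' : IrredundantMod W (g ∘ Fin.castSucc) := by
      refine fun i hi => hg i.castSucc ((sup_le_sup_left (Subgroup.closure_mono ?_) W : _ ≤ _) hi)
      rintro _ ⟨j, hj, rfl⟩
      exact ⟨_, fun h => hj (Fin.castSucc_injective _ h), rfl⟩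
    have hle : W ⊔ closure (Set.range (g ∘ Fin.castSucc)) ≤ W ⊔ closure (Set.range g) :=
      sup_le_sup_left (Subgroup.closure_mono (Set.range_comp_subset_range _ _)) _
    have hne : ∀ X Y : Subgroup G, X.relIndex Y ≠ 0 := fun X Y =>
      FiniteIndex.index_ne_zero (H := X.subgroupOf Y)
    rw [← relIndex_mul_relIndex _ _ _ le_sup_left hle,
      ArithmeticFunction.cardFactors_mul (hne _ _) (hne _ _)]
    refine add_le_add (ih hg') (ArithmeticFunction.cardFactors_pos_iff_one_lt.2
      (Nat.one_lt_iff_ne_zero_and_ne_one.2 ⟨hne _ _, fun h => hg (Fin.last n) ?_⟩))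
    have hlast : g (Fin.last n) ∈ W ⊔ closure (Set.range g) :=
      mem_sup_right (subset_closure ⟨Fin.last n, rfl⟩)
    have := relIndex_eq_one.1 h hlast
    refine (sup_le_sup_left (Subgroup.closure_mono ?_) W : _ ≤ _) this
    rintro _ ⟨j, rfl⟩
    exact ⟨_, Fin.castSucc_ne_last j, rfl⟩

/-- If every prime divisor of `|A|` divides `r`, the `r`-th powers are non-generators. -/
lemma eq_top_of_range_powMonoidHom_sup_eq_top {r : ℕ}
    (hr : ∀ p : ℕ, p.Prime → p ∣ Nat.card A → p ∣ r) {B : Subgroup A}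
    (h : (powMonoidHom r : A →* A).range ⊔ B = ⊤) : B = ⊤ := by
  by_contra hB
  have h1 : B.index ≠ 1 := fun h => hB (index_eq_one.1 h)
  obtain ⟨p, hp, hpB⟩ := Nat.exists_prime_and_dvd h1
  obtain ⟨s, rfl⟩ := hr p hp (hpB.trans B.index_dvd_card)
  have : Fact p.Prime := ⟨hp⟩
  obtain ⟨z, hz⟩ := exists_prime_orderOf_dvd_card' (G := A ⧸ B) p hpB
  have hsurj : Function.Surjective (powMonoidHom (p * s) : A ⧸ B →* A ⧸ B) := by
    intro q
    obtain ⟨a, rfl⟩ := QuotientGroup.mk_surjective q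
    obtain ⟨_, ⟨x, rfl⟩, b, hb, rfl⟩ := mem_sup_of_normal_left.1 (h ▸ mem_top a)
    refine ⟨(x : A ⧸ B), ?_⟩
    rw [QuotientGroup.mk_mul, (QuotientGroup.eq_one_iff b).2 hb, mul_one]
    rfl
  have hinj := Finite.injective_iff_surjective.2 hsurj
  have : z = 1 := hinj (by simp [pow_mul, ← hz, pow_orderOf_eq_one])
  rw [this, orderOf_one] at hz
  exact hp.one_lt.ne hz

lemma IrredundantMod.of_generatesMod {r : ℕ} (hr : ∀ p : ℕ, p.Prime → p ∣ Nat.card A → p ∣ r)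
    {n : ℕ} {g : Fin n → A} (hg : IrredundantMod ⊥ g) (hgen : GeneratesMod ⊥ g) :
    IrredundantMod (powMonoidHom r : A →* A).range g := by
  intro i hi
  have h1 : (powMonoidHom r : A →* A).range ⊔ closure (g '' {j | j ≠ i}) = ⊤ := by
    rw [GeneratesMod, bot_sup_eq] at hgen
    rw [eq_top_iff, ← hgen, closure_le]
    rintro _ ⟨j, rfl⟩
    by_cases hj : j = i
    · exact hj ▸ hi
    · exact mem_sup_right (subset_closure ⟨j, hj, rfl⟩)
  exact hg i (by simp [eq_top_of_range_powMonoidHom_sup_eq_top hr h1])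

/-- For squarefree `r`, the `r`-th powers are an intersection of maximal subgroups. -/
lemma exists_isCoatom_of_notMem_range_powMonoidHom {r : ℕ} (hr : Squarefree r) {x : A}
    (hx : x ∉ (powMonoidHom r : A →* A).range) :
    ∃ K : Subgroup A, IsCoatom K ∧ (powMonoidHom r : A →* A).range ≤ K ∧ x ∉ K := by
  set R := (powMonoidHom r : A →* A).range
  have hpow : ∀ y : A, y ^ r ∈ R := fun y => ⟨y, rfl⟩
  have hd1 : orderOf (x : A ⧸ R) ≠ 1 := fun h =>
    hx ((QuotientGroup.eq_one_iff x).1 (orderOf_eq_one_iff.1 h))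
  obtain ⟨p, hp, e, he⟩ := Nat.exists_prime_and_dvd hd1
  have he0 : 0 < e := Nat.pos_of_ne_zero fun h => (orderOf_pos (x : A ⧸ R)).ne' (by simp [he, h])
  have hdr : orderOf (x : A ⧸ R) ∣ r :=
    orderOf_dvd_of_pow_eq_one ((QuotientGroup.eq_one_iff (x ^ r)).2 (hpow x))
  obtain ⟨s, rfl⟩ : p ∣ r := (Dvd.intro _ he.symm).trans hdr
  have hps : IsCoprime (p : ℤ) (s : ℤ) :=
    Nat.isCoprime_iff_coprime.2 (Nat.coprime_of_squarefree_mul hr)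
  have hxe : x ^ e ∉ R := by
    intro h
    have h1 : (x : A ⧸ R) ^ e = 1 := (QuotientGroup.eq_one_iff (x ^ e)).2 h
    have h2 := Nat.le_of_dvd he0 (orderOf_dvd_of_pow_eq_one h1)
    have := hp.two_le
    nlinarith
  have hxep : (x ^ e) ^ p ∈ R := by
    rw [← pow_mul, mul_comm, ← he]
    exact (QuotientGroup.eq_one_iff _).1 (pow_orderOf_eq_one (x : A ⧸ R))
  obtain ⟨K, ⟨hRK, hzK⟩, hKmax⟩ :=
    (Set.toFinite {X : Subgroup A | R ≤ X ∧ x ^ e ∉ X}).exists_maximal ⟨R, le_rfl, hxe⟩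
  set z := x ^ e
  have hmax : ∀ L, K < L → z ∈ L := fun L hL => by
    by_contra hz
    exact hL.not_ge (hKmax ⟨hRK.trans hL.le, hz⟩ hL.le)
  have hmem : ∀ y ∉ K, ∃ k ∈ K, ∃ m : ℤ, k * y ^ m = z := by
    intro y hy
    have hlt : K < K ⊔ zpowers y :=
      lt_of_le_of_ne le_sup_left fun h => hy (by rw [h]; exact mem_sup_right (mem_zpowers y))
    obtain ⟨k, hk, _, ⟨m, rfl⟩, h⟩ := mem_sup_of_normal_left.1 (hmax _ hlt)
    exact ⟨k, hk, m, h⟩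
  have hyp : ∀ y : A, y ^ p ∈ K := by
    intro y
    by_contra hy
    obtain ⟨k, hk, m, hkm⟩ := hmem _ hy
    refine hzK (mem_of_zpow_mem_of_isCoprime hps (by simpa using hRK hxep) ?_)
    rw [← hkm, mul_zpow]
    refine mul_mem (zpow_mem hk _) ?_
    have : ((y ^ p) ^ m) ^ (s : ℤ) = (y ^ (p * s)) ^ m := by
      rw [← zpow_natCast, ← zpow_natCast, ← zpow_mul, ← zpow_mul, ← zpow_mul]
      congr 1; push_cast; ring
    rw [this]
    exact zpow_mem (hRK (hpow y)) m
  have hgen : ∀ y, y ∈ K ⊔ zpowers z := by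
    intro y
    by_cases hy : y ∈ K
    · exact mem_sup_left hy
    obtain ⟨k, hk, m, hkm⟩ := hmem _ hy
    have hm : ¬ (p : ℤ) ∣ m := by
      rintro ⟨m, rfl⟩
      refine hzK (hkm ▸ mul_mem hk ?_)
      rw [zpow_mul, zpow_natCast]
      exact zpow_mem (hyp y) m
    refine mem_of_zpow_mem_of_isCoprime
      ((Nat.prime_iff_prime_int.1 hp).irreducible.coprime_iff_not_dvd.2 hm)
      (mem_sup_left (by simpa using hyp y)) ?_
    rw [← eq_inv_mul_iff_mul_eq] at hkm
    rw [hkm]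
    exact mul_mem (mem_sup_left (inv_mem hk)) (mem_sup_right (mem_zpowers z))
  refine ⟨K, ⟨fun h => hzK (h ▸ mem_top z), fun L hL => eq_top_iff.2 fun y _ => ?_⟩, hRK,
    fun h => hzK (pow_mem h e)⟩
  exact (sup_le hL.le (by simpa using hmax L hL) : K ⊔ zpowers z ≤ L) (hgen y)

lemma exists_generatesMod_range_powMonoidHom {r : ℕ} (hr : Squarefree r) :
    ∃ (n : ℕ) (g : Fin n → A), IrredundantMod (powMonoidHom r : A →* A).range g ∧
      GeneratesMod (powMonoidHom r : A →* A).range g ∧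
      Ω (powMonoidHom r : A →* A).range.index ≤ n := by
  set R := (powMonoidHom r : A →* A).range
  have key : ∀ W : Subgroup A, R ≤ W →
      (∃ (n : ℕ) (g : Fin n → A), IrredundantMod W g ∧ GeneratesMod W g ∧ Ω W.index ≤ n) →
      ∃ (n : ℕ) (g : Fin n → A), IrredundantMod R g ∧ GeneratesMod R g ∧ Ω R.index ≤ n := by
    intro W
    induction W using WellFoundedLT.induction with
    | ind W ih =>
      rintro hRW hW
      by_cases hWR : W ≤ R
      · rwa [le_antisymm hRW hWR]
      obtain ⟨x, hxW, hxR⟩ := SetLike.not_le_iff_exists.1 hWR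
      obtain ⟨K, hK, hRK, hxK⟩ := exists_isCoatom_of_notMem_range_powMonoidHom hr hxR
      have hWK : ¬ W ≤ K := fun h => hxK (h hxW)
      obtain ⟨n, g, hg, hgen, hn⟩ := hW
      obtain ⟨h, hh, hhgen⟩ := exists_irredundantMod_inf_coatom hK hWK hg hgen
      refine ih _ (lt_of_le_of_ne inf_le_left fun h => hWK (inf_eq_left.1 h)) (le_inf hRW hRK)
        ⟨n + 1, h, hh, hhgen, ?_⟩
      rw [← relIndex_mul_index (inf_le_left : W ⊓ K ≤ W), relIndex_eq_index_of_isCoatom hK hWK,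
        ArithmeticFunction.cardFactors_mul FiniteIndex.index_ne_zero FiniteIndex.index_ne_zero,
        ArithmeticFunction.cardFactors_apply_prime
          (hK.prime_index_of_zpowers_normal inferInstance hxK)]
      omega
  exact key ⊤ le_top ⟨0, Fin.elim0, fun i => i.elim0, by simp [GeneratesMod], by simp⟩

lemma index_range_powMonoidHom (B : Type*) [CommGroup B] [Finite B] (r : ℕ) :
    (powMonoidHom r : B →* B).range.index = Nat.card (powMonoidHom r : B →* B).ker := by
  have h1 := card_mul_index (powMonoidHom r : B →* B).ker
  rw [index_ker, ← card_mul_index (powMonoidHom r : B →* B).range, mul_comm] at h1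
  exact (Nat.eq_of_mul_eq_mul_left Nat.card_pos h1).symm

/-- Finite abelian groups are flat. -/
lemma flatMod_bot_of_commGroup : FlatMod (⊥ : Subgroup A) := by
  intro n g hg
  set r := ∏ p ∈ (Nat.card A).primeFactors, p
  have hr : Squarefree r := by
    refine Finset.squarefree_prod_of_pairwise_isCoprime (fun p hp q hq hpq => ?_)
      fun p hp => (Nat.prime_of_mem_primeFactors hp).prime.squarefree
    exact Nat.coprime_iff_isRelPrime.1 ((Nat.coprime_primes (Nat.prime_of_mem_primeFactors hp)
      (Nat.prime_of_mem_primeFactors hq)).2 hpq)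
  have hrA : ∀ p : ℕ, p.Prime → p ∣ Nat.card A → p ∣ r := fun p hp h =>
    Finset.dvd_prod_of_mem _ (Nat.mem_primeFactors.2 ⟨hp, h, Nat.card_pos.ne'⟩)
  obtain ⟨m, h, hh, hgen, hm⟩ := exists_generatesMod_range_powMonoidHom (A := A) hr
  refine ⟨m, h, ?_, fun i hi => hh i
    ((sup_le_sup_right bot_le _ : _ ≤ _ ⊔ closure (h '' {j | j ≠ i})) hi), ?_⟩
  · set H := closure (Set.range g)
    have hgH : ∀ i, g i ∈ H := fun i => subset_closure ⟨i, rfl⟩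
    set k : Fin n → H := fun i => ⟨g i, hgH i⟩
    have himg : ∀ S : Set (Fin n), (closure (k '' S)).map H.subtype = closure (g '' S) := by
      intro S
      rw [MonoidHom.map_closure, ← Set.image_comp]
      rfl
    have hk : IrredundantMod ⊥ k := by
      intro i hi
      rw [bot_sup_eq] at hi
      have := mem_map_of_mem H.subtype hi
      rw [himg] at this
      exact hg i (mem_sup_right this)
    have hkgen : GeneratesMod ⊥ k := by
      rw [GeneratesMod, bot_sup_eq]
      apply map_injective H.subtype_injective
      rw [← Set.image_univ, himg, Set.image_univ, ← MonoidHom.range_eq_map, range_subtype]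
    have hkr := hk.of_generatesMod (r := r)
      (fun p hp h => hrA p hp (h.trans (card_subgroup_dvd_card H))) hkgen
    refine hkr.le_cardFactors_relIndex.trans (le_trans (cardFactors_le_of_dvd ?_
      FiniteIndex.index_ne_zero) hm)
    refine (relIndex_dvd_index_of_le le_sup_left).trans ?_
    rw [index_range_powMonoidHom, index_range_powMonoidHom]
    have : (powMonoidHom r : H →* H).ker.map H.subtype ≤ (powMonoidHom r : A →* A).ker := by
      rintro _ ⟨x, hx, rfl⟩
      exact congrArg H.subtype hx
    rw [← card_map_of_injective H.subtype_injective]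
    exact card_dvd_of_le this
  · rw [GeneratesMod, bot_sup_eq]
    exact eq_top_of_range_powMonoidHom_sup_eq_top hrA hgen

end Abelian

section Supersolvable

variable {G : Type*} [Group G]

lemma mem_ker_sup_closure_image_iff {Q : Type*} [Group Q] {f : G →* Q} {n : ℕ} {g : Fin n → G}
    (S : Set (Fin n)) (x : G) :
    x ∈ f.ker ⊔ closure (g '' S) ↔ f x ∈ closure ((f ∘ g) '' S) := by
  rw [Set.image_comp, ← MonoidHom.map_closure, ← mem_comap, comap_map_eq, sup_comm]

lemma FlatMod.ker {Q : Type*} [Group Q] {f : G →* Q} (hf : Function.Surjective f)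
    (h : FlatMod (⊥ : Subgroup Q)) : FlatMod f.ker := by
  intro n g hg
  obtain ⟨m, k, hnm, hk, hgen⟩ := h n (f ∘ g) fun i hi =>
    hg i ((mem_ker_sup_closure_image_iff _ _).2 (by simpa using hi))
  choose k' hk' using fun i => hf (k i)
  obtain rfl : f ∘ k' = k := funext hk'
  refine ⟨m, k', hnm, fun i hi => hk i ?_, eq_top_iff.2 fun x _ => ?_⟩
  · simpa using (mem_ker_sup_closure_image_iff _ _).1 hi
  · rw [← Set.image_univ, mem_ker_sup_closure_image_iff, Set.image_univ]
    rw [GeneratesMod, bot_sup_eq] at hgen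
    exact hgen ▸ mem_top _

lemma flatMod_commutator [Finite G] : FlatMod (commutator G) := by
  have := FlatMod.ker (f := (Abelianization.of : G →* Abelianization G))
    QuotientGroup.mk_surjective flatMod_bot_of_commGroup
  rwa [Abelianization.ker_of] at this

lemma exists_isCoatom_of_not_le_frattini {W : Subgroup G} (h : ¬ W ≤ frattini G) :
    ∃ K : Subgroup G, IsCoatom K ∧ ¬ W ≤ K := by
  by_contra! hcon
  exact h (le_iInf₂ hcon)

lemma Supersolvable.flatMod_bot [Finite G] (hG : Supersolvable G)
    (hfrattini : frattini G ⊓ commutator G = ⊥) : FlatMod (⊥ : Subgroup G) := by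
  have hab : ⁅commutator G, commutator G⁆ = ⊥ := by
    rw [eq_bot_iff, ← hfrattini]
    exact le_inf (le_iInf₂ fun K hK => hG.commutator_commutator_le hK) (commutator_le_left _ _)
  have key : ∀ W : Subgroup G, W.Normal → W ≤ commutator G → FlatMod W →
      FlatMod (⊥ : Subgroup G) := by
    intro W
    induction W using WellFoundedLT.induction with
    | ind W ih =>
      intro hn hW hflat
      by_cases hbot : W = ⊥
      · exact hbot ▸ hflat
      obtain ⟨K, hK, hWK⟩ := exists_isCoatom_of_not_le_frattini (W := W) fun h =>
        hbot (eq_bot_iff.2 (hfrattini ▸ le_inf h hW))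
      refine ih (W ⊓ K) (lt_of_le_of_ne inf_le_left fun h => hWK (inf_eq_left.1 h)) ?_
        (inf_le_left.trans hW) (hflat.inf_coatom hK hWK (covBy_of_prime_relIndex inf_le_left ?_))
      · have h1 : K ≤ normalizer (W ⊓ K : Subgroup G) := by
          rw [le_normalizer_iff]
          intro k hk x hx
          exact ⟨hn.conj_mem x hx.1 k, K.mul_mem (K.mul_mem hk hx.2) (K.inv_mem hk)⟩
        have h2 : W ≤ normalizer (W ⊓ K : Subgroup G) := by
          rw [le_normalizer_iff]
          intro w hw x hx
          have : ⁅w, x⁆ = 1 := by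
            rw [← mem_bot, ← hab]
            exact commutator_mem_commutator (hW hw) (hW hx.1)
          rwa [commutatorElement_eq_one_iff_mul_comm.1 this, mul_inv_cancel_right]
        rw [← normalizer_eq_top_iff]
        exact hK.2 _ (lt_of_le_of_ne h1 fun h => hWK (h ▸ h2))
      · rw [relIndex_eq_index_of_isCoatom hK hWK]
        exact hG.prime_index hK
  exact key _ inferInstance le_rfl flatMod_commutator

lemma Irredundant.injective {n : ℕ} {g : Fin n → G} (hg : Irredundant g) :
    Function.Injective g := by
  intro i j h
  by_contra hij
  exact hg i (subset_closure ⟨j, Ne.symm hij, h.symm⟩)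

end Supersolvable

/-- If `G` is a finite supersolvable group with `Φ(G) ∩ [G,G] = 1`, then
`m(G) = i(G)`; that is, `G` is flat. -/
theorem mG_eq_iG_of_supersolvable
    {G : Type*} [Group G] [Finite G] (hG : Supersolvable G)
    (hfrattini : frattini G ⊓ commutator G = ⊥) :
    mG G = iG G := by
  have hfl := hG.flatMod_bot hfrattini
  have hbdd : BddAbove {n | ∃ g : Fin n → G, Irredundant g} := by
    refine ⟨Nat.card G, ?_⟩
    rintro n ⟨g, hg⟩
    simpa using Nat.card_le_card_of_injective g hg.injective
  have hflat : ∀ (n : ℕ) (g : Fin n → G), Irredundant g →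
      ∃ (m : ℕ) (h : Fin m → G), n ≤ m ∧ Irredundant h ∧ Generates h := by
    simpa only [FlatMod, irredundantMod_bot, generatesMod_bot] using hfl
  have hne : {n | ∃ g : Fin n → G, Irredundant g}.Nonempty := ⟨0, Fin.elim0, fun i => i.elim0⟩
  have hsub : {n | ∃ g : Fin n → G, Irredundant g ∧ Generates g} ⊆
      {n | ∃ g : Fin n → G, Irredundant g} := fun n ⟨g, hg, _⟩ => ⟨g, hg⟩
  obtain ⟨g, hg⟩ := Nat.sSup_mem hne hbdd
  obtain ⟨m, h, hm, hh⟩ := hflat _ g hg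
  have hmem : m ∈ {n | ∃ g : Fin n → G, Irredundant g ∧ Generates g} := ⟨h, hh⟩
  exact le_antisymm (csSup_le_csSup hbdd ⟨m, hmem⟩ hsub)
    (hm.trans (le_csSup (hbdd.mono hsub) hmem))
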